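/- arXiv:1507.01364 — 6 statements merged into one kernel-verified Lean document; each statement's English description precedes it below -/
import Mathlib

section
/- Let G be a connected finite simple graph of order n with maximum degree Δ ≥ 2. Then (Δ−1)·Z(G) = (Δ−2)·n + 2 if and only if G is isomorphic to the cycle C_n, to the complete graph K_{Δ+1}, or to the complete bipartite graph K_{Δ,Δ}. -/
/-- The zero forcing closure: `v` eventually becomes colored starting from `S`,
under the rule that a colored vertex all of whose other neighbors are colored
forces its remaining neighbor to become colored. -/
inductive SimpleGraph.ZeroForces {V : Type*} (G : SimpleGraph V) (S : Set V) : V → Prop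
  | init {v : V} (hv : v ∈ S) : SimpleGraph.ZeroForces G S v
  | force {u w : V} (hu : SimpleGraph.ZeroForces G S u) (hadj : G.Adj u w)
      (hall : ∀ v, G.Adj u v → v ≠ w → SimpleGraph.ZeroForces G S v) :
      SimpleGraph.ZeroForces G S w

/-- `S` is a zero forcing set of `G` if every vertex eventually becomes colored. -/
def SimpleGraph.IsZeroForcingSet {V : Type*} (G : SimpleGraph V) (S : Set V) : Prop :=
  ∀ v, G.ZeroForces S v

/-- The zero forcing number of `G`: minimum cardinality of a zero forcing set. -/
noncomputable def SimpleGraph.zeroForcingNumber {V : Type*} (G : SimpleGraph V) : ℕ :=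
  sInf {n | ∃ S : Set V, G.IsZeroForcingSet S ∧ S.ncard = n}

namespace SimpleGraph

open Finset

variable {V : Type*} {G : SimpleGraph V} {S : Set V}

/-- Among two vertices with the same neighbors outside the pair, a zero forcing set contains at
least one. -/
lemma IsZeroForcingSet.mem_or_mem_of_twins (hS : G.IsZeroForcingSet S) {a b : V} (hab : a ≠ b)
    (htwin : ∀ c, c ≠ a → c ≠ b → (G.Adj c a ↔ G.Adj c b)) : a ∈ S ∨ b ∈ S := by
  by_contra! h
  have key : ∀ v, G.ZeroForces S v → v ≠ a ∧ v ≠ b := by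
    intro v hv
    induction hv with
    | init hv => exact ⟨fun e => h.1 (e ▸ hv), fun e => h.2 (e ▸ hv)⟩
    | @force u w _ hadj _ ihu ih =>
      refine ⟨fun e => ?_, fun e => ?_⟩
      · subst e
        exact (ih b ((htwin u ihu.1 ihu.2).1 hadj) hab.symm).2 rfl
      · subst e
        exact (ih a ((htwin u ihu.1 ihu.2).2 hadj) hab).1 rfl
  exact (key a (hS a)).1 rfl

/-- In a nonempty graph without vertices of degree at most one, zero forcing sets have at least
two elements. -/
lemma IsZeroForcingSet.two_le_ncard [Finite V] [Nonempty V] (hS : G.IsZeroForcingSet S)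
    (hdeg : ∀ v w, G.Adj v w → ∃ x, x ≠ w ∧ G.Adj v x) (hne : ∀ v, ∃ w, G.Adj v w) :
    2 ≤ S.ncard := by
  by_contra! hlt
  have hsub : S.Subsingleton := by
    intro a ha b hb
    exact (Set.ncard_le_one (Set.toFinite S)).1 (by lia) a ha b hb
  have key : ∀ v, G.ZeroForces S v → v ∈ S := by
    intro v hv
    induction hv with
    | init hv => exact hv
    | @force u w _ hadj _ ihu ih =>
      obtain ⟨x, hxw, hx⟩ := hdeg u w hadj
      exact absurd (hsub ihu (ih x hx hxw)) hx.ne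
  obtain ⟨v⟩ := ‹Nonempty V›
  obtain ⟨w, hw⟩ := hne v
  exact hw.ne (hsub (key v (hS v)) (key w (hS w)))

lemma IsZeroForcingSet.zeroForcingNumber_le (hS : G.IsZeroForcingSet S) :
    G.zeroForcingNumber ≤ S.ncard :=
  Nat.sInf_le ⟨S, hS, rfl⟩

variable (G) in
lemma exists_isZeroForcingSet_ncard_eq :
    ∃ S : Set V, G.IsZeroForcingSet S ∧ S.ncard = G.zeroForcingNumber :=
  Nat.sInf_mem (s := {n | ∃ S : Set V, G.IsZeroForcingSet S ∧ S.ncard = n})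
    ⟨_, Set.univ, fun v => .init (Set.mem_univ v), rfl⟩

lemma Connected.exists_adj_mem_notMem (hconn : G.Connected) {C : Set V} (hne : C.Nonempty)
    (hC : C ≠ Set.univ) : ∃ u ∈ C, ∃ w ∉ C, G.Adj u w := by
  obtain ⟨a, ha⟩ := hne
  obtain ⟨b, hb⟩ := (Set.ne_univ_iff_exists_notMem C).1 hC
  obtain ⟨p⟩ := hconn a b
  obtain ⟨d, -, h1, h2⟩ := p.exists_boundary_dart C ha hb
  exact ⟨d.fst, h1, d.snd, h2, d.adj⟩

/-- `C` is a nonempty set of vertices inducing a subgraph without isolated vertices, and `C` can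
be colored from some `S ⊆ C` with `(d + 1) * #S + s ≤ d * #C + 2`; here `s` measures the slack. -/
def ColorableWithSlack (G : SimpleGraph V) (d s : ℕ) (C : Finset V) : Prop :=
  C.Nonempty ∧ (∀ v ∈ C, ∃ u ∈ C, G.Adj v u) ∧
    ∃ S ⊆ C, (∀ v ∈ C, G.ZeroForces S v) ∧ (d + 1) * #S + s ≤ d * #C + 2

lemma ZeroForces.mono {T : Set V} (h : S ⊆ T) {v : V} (hv : G.ZeroForces S v) :
    G.ZeroForces T v := by
  induction hv with
  | init hv => exact .init (h hv)
  | force _ hadj _ ihu ih => exact .force ihu hadj ih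

/-- A connected regular graph in which all neighbors of some vertex have the same neighborhood is
balanced complete bipartite. -/
lemma nonempty_iso_completeBipartiteGraph [Fintype V] [DecidableRel G.Adj]
    (hconn : G.Connected) {k : ℕ} (hreg : ∀ v, G.degree v = k) {x u : V} (hxu : G.Adj x u)
    (htwin : ∀ w, G.Adj x w → G.neighborFinset w = G.neighborFinset u) :
    Nonempty (G ≃g completeBipartiteGraph (Fin k) (Fin k)) := by
  have hN : ∀ a, G.Adj u a → G.neighborFinset x = G.neighborFinset a := by
    intro a ha
    refine eq_of_subset_of_card_le (fun w hw => ?_) (by simp [hreg])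
    rw [mem_neighborFinset] at hw ⊢
    have : a ∈ G.neighborFinset w := by rw [htwin w hw]; simpa using ha
    exact ((G.mem_neighborFinset _ _).1 this).symm
  have hNx : ∀ a w, G.Adj u a → (G.Adj a w ↔ G.Adj x w) := fun a w ha => by
    rw [← mem_neighborFinset, ← hN a ha, mem_neighborFinset]
  have hNu : ∀ w a, G.Adj x w → (G.Adj w a ↔ G.Adj u a) := fun w a hw => by
    rw [← mem_neighborFinset, htwin w hw, mem_neighborFinset]
  have hdisj : ∀ a, G.Adj u a → ¬ G.Adj x a := fun a ha hxa =>
    G.irrefl ((hNu a a hxa).2 ha)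
  have hcover : ∀ v, ¬ G.Adj u v → G.Adj x v := by
    by_contra! hv
    obtain ⟨v, hv1, hv2⟩ := hv
    obtain ⟨a, ha, b, hb, hab⟩ := hconn.exists_adj_mem_notMem
      (C := {v | G.Adj u v ∨ G.Adj x v}) ⟨u, .inr hxu⟩
      (by
        intro h
        have : v ∈ (Set.univ : Set V) := Set.mem_univ v
        rw [← h] at this
        exact this.elim hv1 hv2)
    rcases ha with ha | ha
    · exact hb (.inr ((hNx a b ha).1 hab))
    · exact hb (.inl ((hNu a b ha).1 hab))
  have e1 : Fintype.card {v // G.Adj u v} = Fintype.card (Fin k) := by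
    rw [Fintype.card_fin, ← hreg u]
    exact G.card_neighborSet_eq_degree u
  have e2 : Fintype.card {v // ¬ G.Adj u v} = Fintype.card (Fin k) := by
    rw [Fintype.card_fin, ← hreg x, ← G.card_neighborSet_eq_degree x]
    exact Fintype.card_congr
      (Equiv.subtypeEquivRight fun v => ⟨hcover v, fun h h' => hdisj v h' h⟩)
  refine ⟨⟨(Equiv.sumCompl (G.Adj u)).symm.trans
    (Equiv.sumCongr (Fintype.equivOfCardEq e1) (Fintype.equivOfCardEq e2)), ?_⟩⟩
  intro a b
  by_cases ha : G.Adj u a <;> by_cases hb : G.Adj u b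
  · simp [ha, hb, hNx a b ha, hdisj b hb, Equiv.sumCompl_symm_apply_of_pos]
  · simp [ha, hb, hNx a b ha, hcover b hb, Equiv.sumCompl_symm_apply_of_pos,
      Equiv.sumCompl_symm_apply_of_neg]
  · simp [ha, hb, hNu a b (hcover a ha), Equiv.sumCompl_symm_apply_of_pos,
      Equiv.sumCompl_symm_apply_of_neg]
  · simp [ha, hb, hNu a b (hcover a ha), Equiv.sumCompl_symm_apply_of_neg]

section Fintype

variable [Fintype V] [DecidableEq V] [DecidableRel G.Adj] {d s t : ℕ} {C : Finset V}

lemma colorableWithSlack_insert_neighborFinset {v : V} (hpos : 0 < G.degree v)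
    (hs : G.degree v + s = d + 2) :
    G.ColorableWithSlack d s (insert v (G.neighborFinset v)) := by
  obtain ⟨w, hw⟩ := (G.degree_pos_iff_exists_adj v).1 hpos
  refine ⟨insert_nonempty _ _, ?_, insert v ((G.neighborFinset v).erase w), ?_, ?_, ?_⟩
  · intro x hx
    rcases mem_insert.1 hx with rfl | hx
    · exact ⟨w, by simp [hw], hw⟩
    · exact ⟨v, by simp, ((G.mem_neighborFinset _ _).1 hx).symm⟩
  · exact insert_subset_insert _ (erase_subset _ _)
  · have hv : ∀ x ∈ insert v ((G.neighborFinset v).erase w),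
        G.ZeroForces (insert v ((G.neighborFinset v).erase w) : Finset V) x :=
      fun x hx => .init (mem_coe.2 hx)
    intro x hx
    by_cases hxw : x = w
    · subst hxw
      exact .force (hv v (by simp)) hw fun y hy hyx => hv y (by simp [hy, hyx])
    · refine hv x ?_
      simp only [mem_insert, mem_erase] at hx ⊢
      tauto
  · have h1 : v ∉ G.neighborFinset v := by simp
    have h2 : v ∉ (G.neighborFinset v).erase w := by simp
    rw [card_insert_of_notMem h1, card_insert_of_notMem h2,
      card_erase_of_mem (by simpa using hw), card_neighborFinset_eq_degree,
      Nat.sub_add_cancel hpos]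
    nlinarith

lemma ColorableWithSlack.union_neighborFinset (h : G.ColorableWithSlack d s C) {u : V} (hu : u ∈ C)
    (hne : (G.neighborFinset u \ C).Nonempty) (ht : #(G.neighborFinset u \ C) + t = d + 1) :
    G.ColorableWithSlack d (s + t) (C ∪ G.neighborFinset u) := by
  obtain ⟨hCne, hadj, S, hSC, hS, hcard⟩ := h
  obtain ⟨w, hw⟩ := hne
  have hw' := hw
  rw [mem_sdiff, mem_neighborFinset] at hw'
  set X := G.neighborFinset u \ C with hX
  refine ⟨hCne.mono subset_union_left, ?_, S ∪ X.erase w, ?_, ?_, ?_⟩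
  · intro x hx
    rcases mem_union.1 hx with hx | hx
    · obtain ⟨y, hy, hxy⟩ := hadj x hx
      exact ⟨y, mem_union_left _ hy, hxy⟩
    · exact ⟨u, mem_union_left _ hu, ((G.mem_neighborFinset _ _).1 hx).symm⟩
  · exact union_subset_union hSC ((erase_subset _ _).trans sdiff_subset)
  · have hv : ∀ x ∈ C ∪ G.neighborFinset u, x ≠ w → G.ZeroForces (S ∪ X.erase w : Finset V) x := by
      intro x hx hxw
      by_cases hxC : x ∈ C
      · exact (hS x hxC).mono (by simp)
      · refine .init ?_
        simp only [mem_union] at hx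
        have : x ∈ X := by rw [hX, mem_sdiff]; tauto
        simp [this, hxw]
    intro x hx
    by_cases hxw : x = w
    · subst hxw
      exact .force (hv u (mem_union_left _ hu) fun e => hw'.2 (e ▸ hu)) hw'.1
        fun y hy hyx => hv y (by simp [hy]) hyx
    · exact hv x hx hxw
  · have h1 : #(S ∪ X.erase w) ≤ #S + (#X - 1) := by
      rw [← card_erase_of_mem hw]
      exact card_union_le _ _
    have h2 : #(C ∪ G.neighborFinset u) = #C + #X := by
      rw [← union_sdiff_self_eq_union, card_union_of_disjoint disjoint_sdiff]
    have h3 : 0 < #X := card_pos.2 ⟨w, hw⟩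
    obtain ⟨k, hk⟩ : ∃ k, #X = k + 1 := ⟨#X - 1, by lia⟩
    rw [h2, hk]
    rw [hk] at h1 ht
    have h4 : (d + 1) * #(S ∪ X.erase w) ≤ (d + 1) * (#S + k) := Nat.mul_le_mul_left _ h1
    nlinarith

lemma ColorableWithSlack.exists_card_sdiff_add_eq (hdeg : ∀ v, G.degree v ≤ d + 2)
    (h : G.ColorableWithSlack d s C) {u : V} (hu : u ∈ C) :
    ∃ t, #(G.neighborFinset u \ C) + t = d + 1 := by
  obtain ⟨x, hx, hux⟩ := h.2.1 u hu
  have h1 : #(G.neighborFinset u \ C) < #(G.neighborFinset u) :=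
    card_lt_card ⟨sdiff_subset, fun hh => by
      have := hh ((G.mem_neighborFinset _ _).2 hux)
      simp [hx] at this⟩
  have := hdeg u
  rw [card_neighborFinset_eq_degree] at h1
  exact ⟨d + 1 - #(G.neighborFinset u \ C), by lia⟩

lemma ColorableWithSlack.exists_mem_nonempty_sdiff (hconn : G.Connected)
    (h : G.ColorableWithSlack d s C) (hC : C ≠ univ) :
    ∃ u ∈ C, (G.neighborFinset u \ C).Nonempty := by
  obtain ⟨u, hu, w, hw, huw⟩ := hconn.exists_adj_mem_notMem (C := C) h.1 (by simpa using hC)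
  exact ⟨u, hu, w, by simpa using ⟨huw, hw⟩⟩

lemma ColorableWithSlack.exists_univ (hconn : G.Connected) (hdeg : ∀ v, G.degree v ≤ d + 2)
    (h : G.ColorableWithSlack d s C) : ∃ t, s ≤ t ∧ G.ColorableWithSlack d t univ := by
  induction hk : #Cᶜ using Nat.strong_induction_on generalizing C s with
  | _ k ih =>
    by_cases hC : C = univ
    · exact ⟨s, le_rfl, hC ▸ h⟩
    · obtain ⟨u, hu, hne⟩ := h.exists_mem_nonempty_sdiff hconn hC
      obtain ⟨t, ht⟩ := h.exists_card_sdiff_add_eq hdeg hu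
      obtain ⟨w, hw⟩ := hne
      obtain ⟨r, hr, hQ⟩ := ih #(C ∪ G.neighborFinset u)ᶜ (by
        subst hk
        refine card_lt_card ⟨compl_subset_compl.2 subset_union_left, fun hh => ?_⟩
        rw [mem_sdiff] at hw
        have := hh (mem_compl.2 hw.2)
        simp_all) (h.union_neighborFinset hu ⟨w, hw⟩ ht) rfl
      exact ⟨r, by lia, hQ⟩

/-- Completing a partial coloring bounds the zero forcing number. -/
lemma ColorableWithSlack.zeroForcingNumber_le (hconn : G.Connected)
    (hdeg : ∀ v, G.degree v ≤ d + 2) (h : G.ColorableWithSlack d s C) :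
    (d + 1) * G.zeroForcingNumber + s ≤ d * Fintype.card V + 2 := by
  obtain ⟨t, ht, -, -, S, -, hS, hcard⟩ := h.exists_univ hconn hdeg
  have h1 : G.zeroForcingNumber ≤ #S := by
    rw [← Set.ncard_coe_finset]
    exact IsZeroForcingSet.zeroForcingNumber_le fun v => hS v (mem_univ v)
  have h2 : (d + 1) * G.zeroForcingNumber ≤ (d + 1) * #S := Nat.mul_le_mul_left _ h1
  rw [card_univ] at hcard
  lia

lemma nonempty_iso_cycleGraph (hconn : G.Connected) (hreg : ∀ v, G.degree v = 2) :
    Nonempty (G ≃g cycleGraph (Fintype.card V)) := by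
  have hcyc : G.IsCycles := fun v _ => by
    rw [Set.ncard_eq_toFinset_card', ← hreg v]
    rfl
  obtain ⟨v⟩ := hconn.nonempty
  obtain ⟨w, hw⟩ := (G.degree_pos_iff_exists_adj v).1 (by simp [hreg])
  obtain ⟨p, hp, hverts⟩ :=
    hcyc.exists_cycle_toSubgraph_verts_eq_connectedComponentSupp
      (c := G.connectedComponentMk v) (v := v) rfl ⟨w, hw⟩
  have hmem : ∀ x, x ∈ p.support := fun x => by
    rw [← Walk.mem_verts_toSubgraph, hverts]
    exact ConnectedComponent.sound (hconn x v)
  have hlen : p.length = Fintype.card V := by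
    have h1 : #p.support.tail.toFinset = p.length := by
      rw [List.toFinset_card_of_nodup hp.support_nodup]
      simp
    rw [← h1, ← card_univ]
    congr 1
    refine eq_univ_of_forall fun x => ?_
    rw [List.mem_toFinset]
    rcases List.mem_cons.1 (p.cons_tail_support.symm ▸ hmem x) with rfl | h
    · exact Walk.end_mem_tail_support hp.not_nil
    · exact h
  have h3 : 3 ≤ Fintype.card V := hlen ▸ hp.three_le_length
  obtain ⟨f⟩ := (cycleGraph_isContained_iff h3).2 ⟨v, p, hp, hlen⟩
  have hbij : Function.Bijective f.toHom :=
    (Fintype.bijective_iff_injective_and_card _).2 ⟨f.injective, by simp⟩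
  refine ⟨(RelIso.symm ⟨Equiv.ofBijective _ hbij, fun {a b} => ⟨fun hab => ?_, f.toHom.map_adj⟩⟩)⟩
  obtain ⟨m, hm⟩ : ∃ m, Fintype.card V = m + 3 := ⟨_, (Nat.sub_add_cancel h3).symm⟩
  have hdeg : ∀ a, (cycleGraph (Fintype.card V)).degree a = 2 := by
    rw [hm]
    intro a
    exact cycleGraph_degree_three_le
  have himg : ((cycleGraph (Fintype.card V)).neighborFinset a).image f.toHom
      = G.neighborFinset (f.toHom a) := by
    refine eq_of_subset_of_card_le (fun y hy => ?_) ?_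
    · obtain ⟨z, hz, rfl⟩ := mem_image.1 hy
      rw [mem_neighborFinset] at hz ⊢
      exact f.toHom.map_adj hz
    · rw [card_image_of_injective _ f.injective, card_neighborFinset_eq_degree,
        card_neighborFinset_eq_degree, hreg, hdeg]
  have hb : f.toHom b ∈ G.neighborFinset (f.toHom a) := (G.mem_neighborFinset _ _).2 hab
  rw [← himg, mem_image] at hb
  obtain ⟨z, hz, hzb⟩ := hb
  rw [← f.injective hzb]
  exact (mem_neighborFinset _ _ _).1 hz

/-- A coloring without slack stays tight when it is extended. -/
lemma ColorableWithSlack.card_sdiff_eq (hconn : G.Connected) (hdeg : ∀ v, G.degree v ≤ d + 2)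
    (hZ : (d + 1) * G.zeroForcingNumber = d * Fintype.card V + 2)
    (h : G.ColorableWithSlack d 0 C) {u : V} (hu : u ∈ C)
    (hne : (G.neighborFinset u \ C).Nonempty) :
    #(G.neighborFinset u \ C) = d + 1 ∧ G.ColorableWithSlack d 0 (C ∪ G.neighborFinset u) := by
  obtain ⟨t, ht⟩ := h.exists_card_sdiff_add_eq hdeg hu
  have h' := h.union_neighborFinset hu hne ht
  have h0 := h'.zeroForcingNumber_le hconn hdeg
  obtain rfl : t = 0 := by lia
  exact ⟨ht, h'⟩

lemma degree_eq_of_zeroForcingNumber_eq (hconn : G.Connected) (hdeg : ∀ v, G.degree v ≤ d + 2)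
    (hpos : ∀ v, 0 < G.degree v)
    (hZ : (d + 1) * G.zeroForcingNumber = d * Fintype.card V + 2) (v : V) :
    G.degree v = d + 2 := by
  have hs : G.degree v + (d + 2 - G.degree v) = d + 2 := by have := hdeg v; lia
  have := (colorableWithSlack_insert_neighborFinset (hpos v) hs).zeroForcingNumber_le hconn hdeg
  lia

lemma card_sdiff_le_of_mem (hreg : ∀ v, G.degree v = d + 2) {u a b : V} (hab : a ≠ b)
    (ha : G.Adj u a) (hb : G.Adj u b) (haC : a ∈ C) (hbC : b ∈ C) :
    #(G.neighborFinset u \ C) ≤ d := by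
  have h1 : G.neighborFinset u \ C ⊆ ((G.neighborFinset u).erase a).erase b := by
    intro x hx
    rw [mem_sdiff] at hx
    refine mem_erase.2 ⟨fun e => hx.2 (e ▸ hbC), mem_erase.2 ⟨fun e => hx.2 (e ▸ haC), hx.1⟩⟩
  refine (card_le_card h1).trans ?_
  rw [card_erase_of_mem (by simp [hab.symm, hb]), card_erase_of_mem (by simpa using ha),
    card_neighborFinset_eq_degree, hreg]
  lia

/-- In the extremal case, a vertex with two neighbors in a tight set has all its neighbors there. -/
lemma ColorableWithSlack.neighborFinset_subset (hconn : G.Connected)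
    (hreg : ∀ v, G.degree v = d + 2)
    (hZ : (d + 1) * G.zeroForcingNumber = d * Fintype.card V + 2)
    (h : G.ColorableWithSlack d 0 C) {u a b : V} (hu : u ∈ C) (hab : a ≠ b)
    (ha : G.Adj u a) (hb : G.Adj u b) (haC : a ∈ C) (hbC : b ∈ C) :
    G.neighborFinset u ⊆ C := by
  rw [← sdiff_eq_empty_iff_subset]
  by_contra hne
  have h1 := (h.card_sdiff_eq hconn (fun v => (hreg v).le) hZ hu (nonempty_iff_ne_empty.2 hne)).1
  have h2 := card_sdiff_le_of_mem hreg hab ha hb haC hbC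
  lia

lemma colorableWithSlack_zero_insert_neighborFinset (hreg : ∀ v, G.degree v = d + 2) (v : V) :
    G.ColorableWithSlack d 0 (insert v (G.neighborFinset v)) :=
  colorableWithSlack_insert_neighborFinset (by simp [hreg]) (by simp [hreg])

lemma insert_neighborFinset_eq_univ_of_triangle (hconn : G.Connected)
    (hreg : ∀ v, G.degree v = d + 2)
    (hZ : (d + 1) * G.zeroForcingNumber = d * Fintype.card V + 2) {v w w' : V}
    (hw : G.Adj v w) (hw' : G.Adj v w') (hww' : G.Adj w w') :
    insert v (G.neighborFinset v) = univ := by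
  set C := insert v (G.neighborFinset v) with hC
  have hQ : G.ColorableWithSlack d 0 C := colorableWithSlack_zero_insert_neighborFinset hreg v
  have hmem : ∀ a, G.Adj v a → a ∈ C := fun a ha => by simp [hC, ha]
  have hsub : ∀ a b, G.Adj v a → G.Adj v b → G.Adj a b → G.neighborFinset a ⊆ C :=
    fun a b ha hb hab => hQ.neighborFinset_subset hconn hreg hZ (hmem a ha) hb.ne ha.symm hab
      (mem_insert_self _ _) (hmem b hb)
  have hNw : G.neighborFinset w = C.erase w := by
    refine eq_of_subset_of_card_le (fun y hy => ?_) ?_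
    · refine mem_erase.2 ⟨fun e => ?_, hsub w w' hw hw' hww' hy⟩
      subst e
      simp at hy
    · rw [card_erase_of_mem (hmem w hw), hC, card_insert_of_notMem (by simp)]
      simp [hreg]
  by_contra hne
  obtain ⟨u, hu, y, hy⟩ := hQ.exists_mem_nonempty_sdiff hconn hne
  rw [mem_sdiff] at hy
  rcases mem_insert.1 hu with rfl | hvu
  · exact hy.2 (mem_insert_of_mem hy.1)
  · rw [mem_neighborFinset] at hvu
    by_cases huw : u = w
    · subst huw
      exact hy.2 (hsub u w' hvu hw' hww' hy.1)
    · have huw' : G.Adj w u := by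
        rw [← mem_neighborFinset, hNw, mem_erase]
        exact ⟨huw, hu⟩
      exact hy.2 (hsub u w hvu hw huw'.symm hy.1)

lemma nonempty_iso_top (hreg : ∀ v, G.degree v = d) (hcard : Fintype.card V = d + 1) :
    Nonempty (G ≃g (⊤ : SimpleGraph (Fin (d + 1)))) := by
  refine ⟨⟨Fintype.equivFinOfCardEq hcard, ?_⟩⟩
  intro a b
  have : G.neighborFinset a = univ.erase a := by
    refine eq_of_subset_of_card_le (fun y hy => ?_) ?_
    · rw [mem_neighborFinset] at hy
      simp [hy.ne']
    · simp [hreg, hcard]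
  rw [← G.mem_neighborFinset, this]
  simp [eq_comm]

lemma neighborFinset_eq_of_common_neighbors (hconn : G.Connected) (hreg : ∀ v, G.degree v = d + 2)
    (hZ : (d + 1) * G.zeroForcingNumber = d * Fintype.card V + 2)
    (htri : ∀ a b c, G.Adj a b → G.Adj a c → ¬ G.Adj b c) {x y u w : V} (hxy : x ≠ y)
    (hxu : G.Adj x u) (hxw : G.Adj x w) (hyu : G.Adj y u) (hyw : G.Adj y w) :
    G.neighborFinset w = G.neighborFinset u := by
  set C := insert x (G.neighborFinset x) with hC
  have hyC : y ∉ C := by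
    simp only [hC, mem_insert, mem_neighborFinset, not_or]
    exact ⟨hxy.symm, fun h => htri x y u h hxu hyu⟩
  have hQ := ((colorableWithSlack_zero_insert_neighborFinset hreg x).card_sdiff_eq hconn
    (fun v => (hreg v).le) hZ (u := u) (by simp [hxu])
    ⟨y, by rw [mem_sdiff, mem_neighborFinset]; exact ⟨hyu.symm, hyC⟩⟩).2
  have hsub := hQ.neighborFinset_subset hconn hreg hZ (u := w) (by simp [hxw]) hxy hxw.symm
    hyw.symm (by simp) (by simp [hyu.symm])
  refine eq_of_subset_of_card_le (fun z hz => ?_) (by simp [hreg])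
  have h1 := hsub hz
  rw [mem_neighborFinset] at hz
  simp only [mem_union, mem_insert, mem_neighborFinset] at h1 ⊢
  rcases h1 with (rfl | h1) | h1
  · exact hxu.symm
  · exact absurd hz (htri x w z hxw h1)
  · exact h1

lemma nonempty_iso_completeBipartiteGraph_of_triangle_free (hconn : G.Connected) (hd : 0 < d)
    (hreg : ∀ v, G.degree v = d + 2)
    (hZ : (d + 1) * G.zeroForcingNumber = d * Fintype.card V + 2)
    (htri : ∀ a b c, G.Adj a b → G.Adj a c → ¬ G.Adj b c)
    (hne : ∃ v, insert v (G.neighborFinset v) ≠ univ) :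
    Nonempty (G ≃g completeBipartiteGraph (Fin (d + 2)) (Fin (d + 2))) := by
  classical
  obtain ⟨v, hv⟩ := hne
  obtain ⟨C, hC, hmax⟩ := exists_max_image
    (univ.filter fun C : Finset V => G.ColorableWithSlack d 0 C ∧ C ≠ univ) card
    ⟨_, mem_filter.2 ⟨mem_univ _, colorableWithSlack_zero_insert_neighborFinset hreg v, hv⟩⟩
  obtain ⟨-, hQ, hCne⟩ := mem_filter.1 hC
  obtain ⟨u, hu, hXne⟩ := hQ.exists_mem_nonempty_sdiff hconn hCne
  obtain ⟨hXcard, hQ'⟩ := hQ.card_sdiff_eq hconn (fun v => (hreg v).le) hZ hu hXne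
  have huniv : C ∪ G.neighborFinset u = univ := by
    by_contra h
    have h1 := hmax _ (mem_filter.2 ⟨mem_univ _, hQ', h⟩)
    rw [← union_sdiff_self_eq_union, card_union_of_disjoint disjoint_sdiff] at h1
    lia
  have hX : ∀ z, z ∉ C → G.Adj u z := fun z hz => by
    have := mem_univ z
    rw [← huniv, mem_union, mem_neighborFinset] at this
    exact this.resolve_left hz
  obtain ⟨x, hx, y, hy, hxy⟩ := one_lt_card.1 (by lia : 1 < #(G.neighborFinset u \ C))
  rw [mem_sdiff, mem_neighborFinset] at hx
  refine nonempty_iso_completeBipartiteGraph hconn hreg hx.1.symm fun w hxw => ?_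
  have hwC : w ∈ C := by
    by_contra h
    exact htri u x w hx.1 (hX w h) hxw
  have hNw : G.neighborFinset w \ C = G.neighborFinset u \ C := by
    refine eq_of_subset_of_card_le (fun z hz => ?_) ?_
    · rw [mem_sdiff] at hz ⊢
      exact ⟨(G.mem_neighborFinset _ _).2 (hX z hz.2), hz.2⟩
    · rw [hXcard, (hQ.card_sdiff_eq hconn (fun v => (hreg v).le) hZ hwC
        ⟨x, mem_sdiff.2 ⟨(G.mem_neighborFinset _ _).2 hxw.symm, hx.2⟩⟩).1]
  have hwy : G.Adj w y := by
    rw [← hNw] at hy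
    exact (G.mem_neighborFinset _ _).1 (mem_sdiff.1 hy).1
  rw [mem_sdiff, mem_neighborFinset] at hy
  exact neighborFinset_eq_of_common_neighbors hconn hreg hZ htri hxy hx.1.symm hxw hy.1.symm
    hwy.symm

lemma nonempty_iso_of_zeroForcingNumber_eq (hconn : G.Connected) (hdeg : ∀ v, G.degree v ≤ d + 2)
    (hpos : ∀ v, 0 < G.degree v)
    (hZ : (d + 1) * G.zeroForcingNumber = d * Fintype.card V + 2) :
    Nonempty (G ≃g cycleGraph (Fintype.card V)) ∨
      Nonempty (G ≃g (⊤ : SimpleGraph (Fin (d + 2 + 1)))) ∨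
      Nonempty (G ≃g completeBipartiteGraph (Fin (d + 2)) (Fin (d + 2))) := by
  have hreg := degree_eq_of_zeroForcingNumber_eq hconn hdeg hpos hZ
  obtain rfl | hd := Nat.eq_zero_or_pos d
  · exact .inl (nonempty_iso_cycleGraph hconn hreg)
  by_cases h : ∃ v, insert v (G.neighborFinset v) = univ
  · obtain ⟨v, hv⟩ := h
    refine .inr (.inl (nonempty_iso_top hreg ?_))
    rw [← card_univ, ← hv, card_insert_of_notMem (by simp), card_neighborFinset_eq_degree, hreg]
  · push Not at h
    obtain ⟨v⟩ := hconn.nonempty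
    exact .inr (.inr (nonempty_iso_completeBipartiteGraph_of_triangle_free hconn hd hreg hZ
      (fun a b c hab hac hbc =>
        h a (insert_neighborFinset_eq_univ_of_triangle hconn hreg hZ hab hac hbc)) ⟨v, h v⟩))

end Fintype

lemma le_zeroForcingNumber {k : ℕ} (h : ∀ S : Set V, G.IsZeroForcingSet S → k ≤ S.ncard) :
    k ≤ G.zeroForcingNumber := by
  obtain ⟨S, hS, hcard⟩ := G.exists_isZeroForcingSet_ncard_eq
  exact hcard ▸ h S hS

lemma two_le_zeroForcingNumber_of_iso_cycleGraph {m : ℕ} (e : G ≃g cycleGraph (m + 3)) :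
    2 ≤ G.zeroForcingNumber := by
  have : Finite V := Finite.of_equiv _ e.toEquiv.symm
  have : Nonempty V := ⟨e.symm 0⟩
  have hcard : ∀ i : Fin (m + 3), 1 < #((cycleGraph (m + 3)).neighborFinset i) := fun i => by
    rw [card_neighborFinset_eq_degree, cycleGraph_degree_three_le]
    norm_num
  have hdeg : ∀ v w, ∃ x, x ≠ w ∧ G.Adj v x := fun v w => by
    obtain ⟨j, hj, hjw⟩ := exists_mem_ne (hcard (e v)) (e w)
    refine ⟨e.symm j, fun h => hjw (by simp [← h]), ?_⟩
    rw [mem_neighborFinset] at hj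
    rw [← e.map_adj_iff]
    simpa using hj
  exact le_zeroForcingNumber fun S hS => hS.two_le_ncard (fun v w _ => hdeg v w)
    fun v => (hdeg v v).imp fun _ => And.right

lemma le_zeroForcingNumber_of_iso_top {k : ℕ} (e : G ≃g (⊤ : SimpleGraph (Fin (k + 1)))) :
    k ≤ G.zeroForcingNumber := by
  have : Finite V := Finite.of_equiv _ e.toEquiv.symm
  have hadj : ∀ a b, G.Adj a b ↔ a ≠ b := fun a b => by
    rw [← e.map_adj_iff, top_adj, e.injective.ne_iff]
  refine le_zeroForcingNumber fun S hS => ?_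
  have hcompl : Sᶜ.ncard ≤ 1 := by
    rw [Set.ncard_le_one (Set.toFinite _)]
    intro a ha b hb
    by_contra hab
    have := hS.mem_or_mem_of_twins hab fun c hca hcb => by simp [hadj, hca, hcb]
    exact this.elim ha hb
  have hcard : Nat.card V = k + 1 := by simpa using Nat.card_congr e.toEquiv
  have := Set.ncard_add_ncard_compl S
  lia

lemma le_zeroForcingNumber_of_iso_completeBipartiteGraph {k : ℕ}
    (e : G ≃g completeBipartiteGraph (Fin (k + 1)) (Fin (k + 1))) :
    2 * k ≤ G.zeroForcingNumber := by
  have : Finite V := Finite.of_equiv _ e.toEquiv.symm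
  refine le_zeroForcingNumber fun S hS => ?_
  have htwin : ∀ a b, (∀ c, G.Adj c a ↔ G.Adj c b) → a ∉ S → b ∉ S → a = b := by
    intro a b h ha hb
    by_contra hab
    exact (hS.mem_or_mem_of_twins hab fun c _ _ => h c).elim ha hb
  have hcompl : Sᶜ.ncard ≤ 2 := by
    have h := Set.ncard_le_ncard_of_injOn (s := Sᶜ) (t := (Set.univ : Set Bool))
      (fun v => (e v).isLeft) (fun _ _ => Set.mem_univ _) (fun a ha b hb hab => by
        refine htwin a b (fun c => ?_) ha hb
        rw [← e.map_adj_iff, ← e.map_adj_iff]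
        rcases h1 : e a <;> rcases h2 : e b <;> simp_all)
    simpa [Set.ncard_univ] using h
  have hcard : Nat.card V = k + 1 + (k + 1) := by
    simpa using Nat.card_congr e.toEquiv
  have := Set.ncard_add_ncard_compl S
  lia

end SimpleGraph

/-- For a connected graph `G` of order `n` with maximum degree `Δ ≥ 2`,
`(Δ−1)·Z(G) = (Δ−2)·n + 2` iff `G ≅ C_n`, `G ≅ K_{Δ+1}` or `G ≅ K_{Δ,Δ}`. -/
theorem stmt0 {V : Type*} [Fintype V] (G : SimpleGraph V) [DecidableRel G.Adj]
    (n Δ : ℕ) (hn : Fintype.card V = n) (hΔ : G.maxDegree = Δ) (hΔ2 : 2 ≤ Δ)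
    (hconn : G.Connected) :
    (Δ - 1) * G.zeroForcingNumber = (Δ - 2) * n + 2 ↔
      (Nonempty (G ≃g SimpleGraph.cycleGraph n) ∨
        Nonempty (G ≃g (⊤ : SimpleGraph (Fin (Δ + 1)))) ∨
        Nonempty (G ≃g completeBipartiteGraph (Fin Δ) (Fin Δ))) := by
  classical
  subst hn hΔ
  obtain ⟨d, hd⟩ : ∃ d, G.maxDegree = d + 2 := ⟨_, (Nat.sub_add_cancel hΔ2).symm⟩
  have hdeg : ∀ v, G.degree v ≤ d + 2 := fun v => hd ▸ G.degree_le_maxDegree v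
  have := hconn.nonempty
  obtain ⟨v, hv⟩ := G.exists_maximal_degree_vertex
  have hcard : d + 2 < Fintype.card V := by
    rw [← hd, hv]
    exact G.degree_lt_card_verts v
  have : Nontrivial V := Fintype.one_lt_card_iff_nontrivial.1 (by lia)
  have hpos : ∀ v, 0 < G.degree v := fun v => hconn.preconnected.degree_pos_of_nontrivial v
  have hle : (d + 1) * G.zeroForcingNumber ≤ d * Fintype.card V + 2 := by
    have := (SimpleGraph.colorableWithSlack_insert_neighborFinset (d := d) (v := v) (s := 0)
      (hpos v) (by lia)).zeroForcingNumber_le hconn hdeg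
    lia
  rw [hd, Nat.add_sub_cancel, show d + 2 - 1 = d + 1 by lia]
  refine ⟨SimpleGraph.nonempty_iso_of_zeroForcingNumber_eq hconn hdeg hpos,
    fun h => le_antisymm hle ?_⟩
  rcases h with ⟨⟨e⟩⟩ | ⟨⟨e⟩⟩ | ⟨⟨e⟩⟩
  · obtain ⟨m, hm⟩ : ∃ m, Fintype.card V = m + 3 := ⟨Fintype.card V - 3, by lia⟩
    have hdeg2 : G.degree v = 2 := by
      rw [hm] at e
      rw [← e.degree_eq v]
      exact SimpleGraph.cycleGraph_degree_three_le
    obtain rfl : d = 0 := by lia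
    have : 2 ≤ G.zeroForcingNumber := by
      rw [hm] at e
      exact SimpleGraph.two_le_zeroForcingNumber_of_iso_cycleGraph e
    lia
  · have h1 := SimpleGraph.le_zeroForcingNumber_of_iso_top e
    have h2 : Fintype.card V = d + 2 + 1 := by simpa using Fintype.card_congr e.toEquiv
    rw [h2]
    nlinarith
  · have h1 := SimpleGraph.le_zeroForcingNumber_of_iso_completeBipartiteGraph e
    have h2 : Fintype.card V = d + 2 + (d + 2) := by simpa using Fintype.card_congr e.toEquiv
    rw [h2]
    nlinarith
end

section
/- For every integer m ≥ 2, the zero forcing number of the complete bipartite graph K_{m,m} equals 2m − 2. -/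
/-- A zero forcing set contains at least one of any two vertices with the same neighbors. -/
theorem SimpleGraph.IsZeroForcingSet.mem_or_mem_of_twins_s4 {V : Type*} {G : SimpleGraph V}
    {S : Set V} (hS : G.IsZeroForcingSet S) {a b : V} (hab : a ≠ b)
    (htwin : ∀ u, G.Adj u a ↔ G.Adj u b) : a ∈ S ∨ b ∈ S := by
  by_contra! h
  obtain ⟨ha, hb⟩ := h
  have key : ∀ v, G.ZeroForces S v → v ≠ a ∧ v ≠ b := by
    intro v hv
    induction hv with
    | init hv => exact ⟨fun h => ha (h ▸ hv), fun h => hb (h ▸ hv)⟩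
    | force _ hadj _ _ ih =>
      constructor
      · rintro rfl
        exact (ih b ((htwin _).1 hadj) hab.symm).2 rfl
      · rintro rfl
        exact (ih a ((htwin _).2 hadj) hab).1 rfl
  exact (key a (hS a)).1 rfl

/-- A zero forcing set of a finite complete bipartite graph misses at most one vertex
of each part. -/
theorem SimpleGraph.IsZeroForcingSet.card_le_ncard_add_two {V W : Type*} [Finite V] [Finite W]
    {S : Set (V ⊕ W)} (hS : (completeBipartiteGraph V W).IsZeroForcingSet S) :
    Nat.card V + Nat.card W ≤ S.ncard + 2 := by
  have hinj : Set.InjOn Sum.isLeft Sᶜ := by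
    intro a ha b hb h
    by_contra hab
    have htwin : ∀ u, (completeBipartiteGraph V W).Adj u a ↔
        (completeBipartiteGraph V W).Adj u b := by
      intro u
      cases u <;> cases a <;> cases b <;> simp_all
    rcases hS.mem_or_mem_of_twins_s4 hab htwin with h | h
    exacts [ha h, hb h]
  have hle : Sᶜ.ncard ≤ 2 := by
    calc Sᶜ.ncard = (Sum.isLeft '' Sᶜ).ncard := hinj.ncard_image.symm
      _ ≤ Nat.card Bool := Set.ncard_le_card _
      _ = 2 := by simp
  have hadd := Set.ncard_add_ncard_compl S
  rw [Nat.card_sum] at hadd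
  omega

/-- In a complete bipartite graph whose parts each have at least two vertices, deleting one
vertex from each part leaves a zero forcing set. -/
theorem SimpleGraph.isZeroForcingSet_completeBipartiteGraph_compl_pair {V W : Type*}
    [Nontrivial V] [Nontrivial W] (a : V) (b : W) :
    (completeBipartiteGraph V W).IsZeroForcingSet {Sum.inl a, Sum.inr b}ᶜ := by
  obtain ⟨a', ha'⟩ := exists_ne a
  obtain ⟨b', hb'⟩ := exists_ne b
  intro v
  by_cases hv : v ∈ ({Sum.inl a, Sum.inr b}ᶜ : Set (V ⊕ W))
  · exact .init hv
  · obtain rfl | rfl : v = Sum.inl a ∨ v = Sum.inr b := by simpa [or_iff_not_imp_left] using hv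
    · refine .force (u := Sum.inr b') (.init (by simpa using hb')) (by simp) ?_
      rintro (v | v) hadj hne
      · exact .init (by simpa using hne)
      · simp at hadj
    · refine .force (u := Sum.inl a') (.init (by simpa using ha')) (by simp) ?_
      rintro (v | v) hadj hne
      · simp at hadj
      · exact .init (by simpa using hne)

/-- For every `m ≥ 2`, the zero forcing number of the complete bipartite
graph `K_{m,m}` is `2m − 2`. -/
theorem stmt4 (m : ℕ) (hm : 2 ≤ m) :
    (completeBipartiteGraph (Fin m) (Fin m)).zeroForcingNumber = 2 * m - 2 := by
  have : Nontrivial (Fin m) := Fin.nontrivial_iff_two_le.2 hm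
  let z : Fin m := ⟨0, by omega⟩
  refine IsLeast.csInf_eq ⟨⟨{Sum.inl z, Sum.inr z}ᶜ,
    SimpleGraph.isZeroForcingSet_completeBipartiteGraph_compl_pair z z, ?_⟩, ?_⟩
  · rw [Set.ncard_compl, Set.ncard_pair (by simp), Nat.card_sum, Nat.card_fin, two_mul]
  · rintro n ⟨S, hS, rfl⟩
    have hle := hS.card_le_ncard_add_two
    rw [Nat.card_fin] at hle
    omega
end

section
/- Let T be a finite tree with exactly k leaves, where k ≥ 2. If S is any set consisting of k − 1 of the leaves of T, then S is a zero forcing set of T. -/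
/-- In a tree, a vertex `w` has at most one neighbor closer to a given root `r`. -/
theorem SimpleGraph.IsTree.eq_of_adj_of_dist_eq_add_one {V : Type*} {T : SimpleGraph V}
    (hT : T.IsTree) {r w a b : V} (ha : T.Adj w a) (hb : T.Adj w b)
    (hda : T.dist r w = T.dist r a + 1) (hdb : T.dist r w = T.dist r b + 1) : a = b := by
  obtain ⟨p, hp⟩ := hT.connected.exists_walk_length_eq_dist r a
  obtain ⟨q, hq⟩ := hT.connected.exists_walk_length_eq_dist r b
  have hp' : (p.concat ha.symm).IsPath :=
    SimpleGraph.Walk.isPath_of_length_eq_dist _ (by simp [hp, hda])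
  have hq' : (q.concat hb.symm).IsPath :=
    SimpleGraph.Walk.isPath_of_length_eq_dist _ (by simp [hq, hdb])
  have h := (hT.existsUnique_path r w).unique hp' hq'
  simpa using congrArg SimpleGraph.Walk.penultimate h

/-- In a tree with root leaf `r`, if `S` contains every leaf other than `r`,
then `S` is a zero forcing set. -/
theorem SimpleGraph.IsTree.isZeroForcingSet_of_leaf {V : Type*} [Fintype V]
    {T : SimpleGraph V} [DecidableRel T.Adj] (hT : T.IsTree) {r : V} (hr : T.degree r = 1)
    {S : Set V} (hS : ∀ v, T.degree v = 1 → v ≠ r → v ∈ S) : T.IsZeroForcingSet S := by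
  have hstep : ∀ v, v ∉ S → ∃ w, T.Adj v w ∧ T.dist r w = T.dist r v + 1 := by
    intro v hv
    obtain ⟨x, hx⟩ := (T.degree_pos_iff_exists_adj r).mp (by omega)
    have : Nontrivial V := ⟨r, x, hx.ne⟩
    have hpos := hT.connected.preconnected.degree_pos_of_nontrivial v
    by_cases hvr : v = r
    · subst hvr
      exact ⟨x, hx, by simpa using SimpleGraph.dist_eq_one_iff_adj.mpr hx⟩
    · have hdeg : 1 < T.degree v := by
        have : T.degree v ≠ 1 := fun h ↦ hv (hS v h hvr)
        omega
      rw [← T.card_neighborFinset_eq_degree, Finset.one_lt_card] at hdeg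
      obtain ⟨a, ha, b, hb, hab⟩ := hdeg
      rw [SimpleGraph.mem_neighborFinset] at ha hb
      rcases hT.dist_eq_dist_add_one_of_adj r ha with h | h
      · rcases hT.dist_eq_dist_add_one_of_adj r hb with h' | h'
        · exact absurd (hT.eq_of_adj_of_dist_eq_add_one ha hb h h') hab
        · exact ⟨b, hb, h'⟩
      · exact ⟨a, ha, h⟩
  have hforce : ∀ n v, Finset.univ.sup (T.dist r) < T.dist r v + n → T.ZeroForces S v := by
    intro n
    induction n with
    | zero =>
      intro v hv
      exact absurd (Finset.le_sup (f := T.dist r) (Finset.mem_univ v)) (by omega)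
    | succ n ih =>
      intro v hv
      by_cases hvS : v ∈ S
      · exact .init hvS
      obtain ⟨w, hvw, hw⟩ := hstep v hvS
      refine .force (ih w (by omega)) hvw.symm fun u hwu huv ↦ ih u ?_
      rcases hT.dist_eq_dist_add_one_of_adj r hwu with h | h
      · exact absurd (hT.eq_of_adj_of_dist_eq_add_one hwu hvw.symm h hw) huv
      · omega
  exact fun v ↦ hforce (Finset.univ.sup (T.dist r) + 1) v (by omega)

/-- If `T` is a tree with exactly `k ≥ 2` leaves and `S` is a set
consisting of `k − 1` of the leaves of `T`, then `S` is a zero forcing set of `T`. -/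
theorem stmt5 {V : Type*} [Fintype V] (T : SimpleGraph V) [DecidableRel T.Adj]
    (htree : T.IsTree) (k : ℕ) (hk : 2 ≤ k)
    (hleaves : {v : V | T.degree v = 1}.ncard = k)
    (S : Set V) (hS : S ⊆ {v : V | T.degree v = 1}) (hcard : S.ncard = k - 1) :
    T.IsZeroForcingSet S := by
  have hdiff : ({v : V | T.degree v = 1} \ S).ncard = 1 := by
    rw [Set.ncard_sdiff hS, hleaves, hcard]
    omega
  obtain ⟨r, hr⟩ := Set.ncard_eq_one.mp hdiff
  have hmem : r ∈ {v : V | T.degree v = 1} \ S := hr ▸ Set.mem_singleton r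
  refine htree.isZeroForcingSet_of_leaf hmem.1 fun v hv hvr ↦ ?_
  by_contra hvS
  have : v ∈ ({r} : Set V) := hr ▸ ⟨hv, hvS⟩
  exact hvr this
end

section
/- Let G be a connected Δ-regular finite simple graph of order n with Δ ≥ 3 satisfying (Δ−1)·Z(G) = (Δ−2)·n + 2. Let S be a zero forcing set of G of minimum cardinality among all zero forcing sets whose complement induces a connected subgraph, and let S̄ = V(G)∖S. If |S̄| = 1, then Δ = n − 1 and G is isomorphic to the complete graph K_{Δ+1}. -/
/-- If `u ∉ {a, b}` is adjacent to exactly `a` among the endpoints of an edge `ab`, then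
`{a, b}ᶜ` is a zero forcing set. -/
theorem SimpleGraph.isZeroForcingSet_compl_pair {V : Type*} {G : SimpleGraph V} {a b u : V}
    (hab : G.Adj a b) (hub : u ≠ b) (hua : G.Adj u a) (hnub : ¬ G.Adj u b) :
    G.IsZeroForcingSet ({a, b} : Set V)ᶜ := by
  have hinit : ∀ v, v ≠ a → v ≠ b → G.ZeroForces ({a, b} : Set V)ᶜ v := fun v h h' =>
    .init (by simp [h, h'])
  have ha : G.ZeroForces ({a, b} : Set V)ᶜ a :=
    .force (hinit u hua.ne hub) hua fun v hv hva => hinit v hva fun h => hnub (h ▸ hv)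
  intro v
  by_cases hva : v = a
  · exact hva ▸ ha
  by_cases hvb : v = b
  · rw [hvb]
    exact .force ha hab fun w hw hwb => hinit w hw.ne' hwb
  exact hinit v hva hvb

/-- A connected graph in which adjacent vertices have the same closed neighborhood is complete. -/
theorem SimpleGraph.Connected.eq_top_of_adj_twins {V : Type*} {G : SimpleGraph V}
    (hconn : G.Connected)
    (htwin : ∀ a b u, G.Adj a b → u ≠ b → G.Adj u a → G.Adj u b) : G = ⊤ := by
  have hwalk : ∀ {a b : V}, G.Walk a b → a ≠ b → G.Adj a b := by
    intro a b p
    induction p with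
    | nil => exact fun h => absurd rfl h
    | @cons x y z hxy _ ih =>
      intro hxz
      by_cases hyz : y = z
      · exact hyz ▸ hxy
      · exact htwin y z x (ih hyz) hxz hxy
  ext a b
  refine ⟨fun h => h.ne, fun h => ?_⟩
  obtain ⟨p⟩ := hconn.preconnected a b
  exact hwalk p h

/-- Under the equality hypothesis, if `|S̄| = 1` then `Δ = n − 1` and
`G` is isomorphic to the complete graph `K_{Δ+1}`. -/
theorem stmt9 {V : Type*} [Fintype V] (G : SimpleGraph V) [DecidableRel G.Adj]
    (n Δ : ℕ) (hn : Fintype.card V = n) (hΔ3 : 3 ≤ Δ)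
    (hreg : G.IsRegularOfDegree Δ) (hconn : G.Connected)
    (hZ : (Δ - 1) * G.zeroForcingNumber = (Δ - 2) * n + 2)
    (S : Set V) (hzf : G.IsZeroForcingSet S)
    (hSc : (G.induce Sᶜ).Connected)
    (hmin : ∀ T : Set V, G.IsZeroForcingSet T → (G.induce Tᶜ).Connected →
      S.ncard ≤ T.ncard)
    (hcard : (Sᶜ : Set V).ncard = 1) :
    Δ = n - 1 ∧ Nonempty (G ≃g (⊤ : SimpleGraph (Fin (Δ + 1)))) := by
  classical
  have htop : G = ⊤ := by
    refine hconn.eq_top_of_adj_twins fun a b u hab hub hua => ?_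
    by_contra hnub
    have hpair : (G.induce ((({a, b} : Set V)ᶜ)ᶜ)).Connected := by
      rw [compl_compl]
      exact SimpleGraph.induce_pair_connected_of_adj hab
    have hle := hmin _ (SimpleGraph.isZeroForcingSet_compl_pair hab hub hua hnub) hpair
    have h₁ := Set.ncard_add_ncard_compl S
    have h₂ := Set.ncard_add_ncard_compl ({a, b} : Set V)
    rw [Set.ncard_pair hab.ne] at h₂
    omega
  obtain ⟨v⟩ := hconn.nonempty
  have hdeg : Δ = Fintype.card V - 1 := by
    subst htop
    rw [← hreg v]
    convert SimpleGraph.complete_graph_degree v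
  have hpos : 0 < Fintype.card V := Fintype.card_pos_iff.mpr ⟨v⟩
  refine ⟨hn ▸ hdeg, ?_⟩
  rw [htop]
  exact ⟨SimpleGraph.Iso.completeGraph (Fintype.equivFinOfCardEq (by omega))⟩
end

section
/- Let G be a connected Δ-regular finite simple graph of order n with Δ ≥ 3 satisfying (Δ−1)·Z(G) = (Δ−2)·n + 2. Let S be a zero forcing set of G of minimum cardinality among all zero forcing sets whose complement induces a connected subgraph, and let S̄ = V(G)∖S, so that G[S̄] is a tree and every vertex of S has exactly one neighbor in S̄. Let x be a leaf of the tree G[S̄] with |S̄| ≥ 2, and let X = N(x) ∩ S. If X is an independent set of G, then N(x_i) ∩ S = N(x_j) ∩ S for any two vertices x_i, x_j ∈ X, and this common set Y = N(x_i) ∩ S is an independent set of G of cardinality Δ − 1; moreover, if some y_i ∈ Y has unique neighbor z_i in S̄ and z_i is a leaf of the tree G[S̄], then every vertex of Y has z_i as its unique neighbor in S̄, i.e. N(Y) ∩ S̄ = {z_i}. -/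
namespace SimpleGraph

/-- A tree rooted at `r`: every vertex has at most one neighbor that is not farther from `r`. -/
theorem IsTree.eq_of_adj_of_dist_le {W : Type*} {T : SimpleGraph W} (hT : T.IsTree) (r : W)
    {v a b : W} (ha : T.Adj v a) (hb : T.Adj v b) (hda : T.dist r a ≤ T.dist r v)
    (hdb : T.dist r b ≤ T.dist r v) : a = b := by
  classical
  obtain ⟨q, hq, -⟩ := hT.connected.exists_path_of_dist r v
  have key : ∀ c, T.Adj v c → T.dist r c ≤ T.dist r v → c = q.penultimate := by
    intro c hc hdc
    obtain ⟨p, hp, hpl⟩ := hT.connected.exists_path_of_dist r c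
    refine hT.isAcyclic.eq_penultimate_of_adj_end hq hc ?_
    by_contra hcq
    have hv : v ∈ p.support :=
      hT.isAcyclic.mem_support_of_ne_mem_support_of_adj_of_isPath hp hq hc.symm hcq
    have hlt := Walk.length_takeUntil_lt_length hv hc.ne
    have hle := dist_le (p.takeUntil v hv)
    omega
  rw [key a ha hda, key b hb hdb]

/-- Let every vertex outside `F` other than `x` have no or at least two neighbors in `F`. If `g` is
a vertex of `F` farthest from the root `r`, then `x` is the only possible child of `g`. -/
theorem IsTree.eq_of_adj_of_dist_lt_of_forall_dist_le {W : Type*} {T : SimpleGraph W}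
    (hT : T.IsTree) {F : Set W} {x r g : W} (hg : g ∈ F)
    (hmax : ∀ f ∈ F, T.dist r f ≤ T.dist r g)
    (hF : ∀ c ∉ F, c ≠ x → ∀ h ∈ F, T.Adj c h → ∃ h' ∈ F, h' ≠ h ∧ T.Adj c h')
    {a : W} (ha : T.Adj g a) (hd : T.dist r g < T.dist r a) : a = x := by
  by_contra hax
  have haF : a ∉ F := fun h => (hmax a h).not_gt hd
  obtain ⟨h, hhF, hne, hadj⟩ := hF a haF hax g hg ha.symm
  exact hne (hT.eq_of_adj_of_dist_le r hadj ha.symm ((hmax h hhF).trans hd.le) hd.le)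

/-- If a set of vertices does not force everything, its set of uncolored vertices is nonempty and
no vertex outside has exactly one neighbor in it. -/
theorem exists_fort_of_not_isZeroForcingSet {V : Type*} {G : SimpleGraph V} {A : Set V}
    (h : ¬ G.IsZeroForcingSet A) :
    ∃ F : Set V, F.Nonempty ∧ Disjoint F A ∧
      ∀ u ∉ F, ∀ w ∈ F, G.Adj u w → ∃ w' ∈ F, w' ≠ w ∧ G.Adj u w' := by
  refine ⟨{v | ¬ G.ZeroForces A v}, ?_, ?_, ?_⟩
  · simpa [IsZeroForcingSet, Set.Nonempty] using h
  · exact Set.disjoint_left.2 fun v hv hA => hv (.init hA)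
  · intro u hu w hw hadj
    by_contra! hcon
    refine hw (.force (not_not.1 hu) hadj fun v hv hne => ?_)
    by_contra hnv
    exact hcon v hnv hne hv

/-- The neighbors of a vertex of a regular graph split into those in `S` and those outside. -/
theorem IsRegularOfDegree.ncard_inter_add_ncard {V : Type*} [Fintype V] {G : SimpleGraph V}
    [DecidableRel G.Adj] {d : ℕ} (hreg : G.IsRegularOfDegree d) (S : Set V) (v : V) :
    (G.neighborSet v ∩ S).ncard + {w : V | w ∈ Sᶜ ∧ G.Adj v w}.ncard = d := by
  have h1 : {w : V | w ∈ Sᶜ ∧ G.Adj v w} = G.neighborSet v \ S := by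
    ext w; simp [and_comm]
  rw [h1, Set.ncard_inter_add_ncard_sdiff_eq_ncard, ← hreg v, ← card_neighborSet_eq_degree,
    Set.ncard_eq_toFinset_card', Set.toFinset_card]

/-- Counting the edges between `S` and its complement. -/
theorem IsRegularOfDegree.ncard_add_two_mul_ncard_compl {V : Type*} [Fintype V]
    {G : SimpleGraph V} [DecidableRel G.Adj] {d : ℕ} (hreg : G.IsRegularOfDegree d) {S : Set V}
    (htree : (G.induce Sᶜ).IsTree) (hone : ∀ v ∈ S, {w : V | w ∈ Sᶜ ∧ G.Adj v w}.ncard = 1) :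
    S.ncard + 2 * Sᶜ.ncard = d * Sᶜ.ncard + 2 := by
  classical
  have hdeg : ∀ w : ↥Sᶜ, (Finset.univ.filter fun v : S => G.Adj v w).card +
      (G.induce Sᶜ).degree w = d := by
    intro w
    rw [← hreg.ncard_inter_add_ncard S w]
    congr 1
    · rw [← Set.ncard_coe_finset, ← Set.ncard_image_of_injective _ Subtype.val_injective]
      congr 1
      ext v
      simp [G.adj_comm, and_comm]
    · rw [← card_neighborFinset_eq_degree, ← Set.ncard_coe_finset,
        ← Set.ncard_image_of_injective _ Subtype.val_injective]
      congr 1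
      ext v
      simp [and_comm]
  have hS : ∀ v : S, (Finset.univ.filter fun w : ↥Sᶜ => G.Adj v w).card = 1 := by
    intro v
    rw [← hone v v.2, ← Set.ncard_coe_finset, ← Set.ncard_image_of_injective _ Subtype.val_injective]
    congr 1
    ext v
    simp [and_comm]
  have hdc := Finset.sum_card_bipartiteAbove_eq_sum_card_bipartiteBelow
    (s := (Finset.univ : Finset S)) (t := (Finset.univ : Finset ↥Sᶜ))
    (fun (v : S) (w : ↥Sᶜ) => G.Adj v w)
  simp only [Finset.bipartiteAbove, Finset.bipartiteBelow, hS] at hdc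
  have hsum := Finset.sum_congr (rfl : (Finset.univ : Finset ↥Sᶜ) = Finset.univ)
    fun w _ => hdeg w
  rw [Finset.sum_add_distrib, ← hdc, sum_degrees_eq_twice_card_edges] at hsum
  have hedge := htree.card_edgeFinset
  simp only [Finset.sum_const, Finset.card_univ, smul_eq_mul, ← Nat.card_eq_fintype_card,
    Nat.card_coe_set_eq] at hsum hedge
  rw [mul_comm d]
  omega

/-- A set attaining the extremal bound is a minimum zero forcing set. -/
theorem IsRegularOfDegree.ncard_eq_zeroForcingNumber {V : Type*} [Fintype V]
    {G : SimpleGraph V} [DecidableRel G.Adj] {d : ℕ} (hreg : G.IsRegularOfDegree d) (hd : 2 ≤ d)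
    (hZ : (d - 1) * G.zeroForcingNumber = (d - 2) * Fintype.card V + 2) {S : Set V}
    (htree : (G.induce Sᶜ).IsTree) (hone : ∀ v ∈ S, {w : V | w ∈ Sᶜ ∧ G.Adj v w}.ncard = 1) :
    S.ncard = G.zeroForcingNumber := by
  have h1 := hreg.ncard_add_two_mul_ncard_compl htree hone
  have h2 := Set.ncard_add_ncard_compl S
  rw [Nat.card_eq_fintype_card] at h2
  rw [← h2] at hZ
  obtain ⟨e, rfl⟩ := Nat.exists_eq_add_of_le' hd
  have h3 : S.ncard = e * Sᶜ.ncard + 2 := by linarith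
  refine Nat.eq_of_mul_eq_mul_left (show 0 < e + 2 - 1 by omega) ?_
  rw [hZ, show e + 2 - 1 = e + 1 by omega, show e + 2 - 2 = e by omega]
  linarith

/-- A fort disjoint from the initial set stays uncolored. -/
theorem ZeroForces.notMem_fort {V : Type*} {G : SimpleGraph V} {A F : Set V}
    (hFA : Disjoint F A) (hF : ∀ u ∉ F, ∀ w ∈ F, G.Adj u w → ∃ w' ∈ F, w' ≠ w ∧ G.Adj u w')
    {v : V} (hv : G.ZeroForces A v) : v ∉ F := by
  induction hv with
  | init hv => exact fun h => Set.disjoint_left.1 hFA h hv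
  | force hu hadj hall ihu ihall =>
    intro hw
    obtain ⟨w', hw', hne, hadj'⟩ := hF _ ihu _ hw hadj
    exact ihall w' hadj' hne hw'

/-- Let `S` be a zero forcing set whose complement is a tree, each vertex of `S` having a unique
neighbor outside `S`. If `x` is a leaf of this tree with independent neighborhood in `S` and
`S \ {s}` is not zero forcing for a neighbor `s` of `x`, then the tree is a single edge `xp` and
`s`, `p` have the same neighbors in `S`. -/
theorem IsRegularOfDegree.exists_neighborSet_inter_eq {V : Type*} [Fintype V]
    {G : SimpleGraph V} [DecidableRel G.Adj] {d : ℕ} (hreg : G.IsRegularOfDegree d) (hd : 3 ≤ d)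
    {S : Set V} (hzf : G.IsZeroForcingSet S) (htree : (G.induce Sᶜ).IsTree)
    (hone : ∀ v ∈ S, {w : V | w ∈ Sᶜ ∧ G.Adj v w}.ncard = 1) {x : V} (hx : x ∈ Sᶜ)
    (hleaf : {w : V | w ∈ Sᶜ ∧ G.Adj x w}.ncard = 1)
    (hindep : ∀ a ∈ G.neighborSet x ∩ S, ∀ b ∈ G.neighborSet x ∩ S, ¬ G.Adj a b)
    {s : V} (hs : s ∈ G.neighborSet x ∩ S) (hns : ¬ G.IsZeroForcingSet (S \ {s})) :
    ∃ p ∈ Sᶜ, G.Adj x p ∧ (∀ w ∈ Sᶜ, G.Adj p w → w = x) ∧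
      G.neighborSet s ∩ S = G.neighborSet p ∩ S := by
  obtain ⟨hxs, hsS⟩ := hs
  rw [mem_neighborSet] at hxs
  have huniq : ∀ v ∈ S, ∀ w ∈ Sᶜ, ∀ w' ∈ Sᶜ, G.Adj v w → G.Adj v w' → w = w' := by
    intro v hv w hw w' hw' h h'
    exact (Set.ncard_le_one_iff (Set.toFinite _)).1 (hone v hv).le ⟨hw, h⟩ ⟨hw', h'⟩
  obtain ⟨F, hFne, hFdisj, hF⟩ := exists_fort_of_not_isZeroForcingSet hns
  have hFS : ∀ v ∈ F, v ≠ s → v ∈ Sᶜ := fun v hv hvs hvS =>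
    Set.disjoint_left.1 hFdisj hv ⟨hvS, hvs⟩
  have hsF : s ∈ F := by
    by_contra hsF
    obtain ⟨v, hv⟩ := hFne
    refine (hzf v).notMem_fort (Set.disjoint_left.2 fun u hu => ?_) hF hv
    exact hFS u hu (ne_of_mem_of_not_mem hu hsF)
  have hnbr : ∀ v ∈ S, v ≠ s → ∀ f ∈ F, f ∈ Sᶜ → G.Adj v f → G.Adj s v := by
    intro v hv hvs f hf hfS hadj
    obtain ⟨w, hw, hne, hvw⟩ := hF v (fun h => hFS v h hvs hv) f hf hadj
    by_cases hws : w = s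
    · exact hws ▸ hvw.symm
    · exact absurd (huniq v hv w (hFS w hw hws) f hfS hvw hadj) hne
  have hxF : x ∉ F := by
    intro hxF
    have hcard := hreg.ncard_inter_add_ncard S x
    obtain ⟨y, hy, hys⟩ := Set.exists_ne_of_one_lt_ncard
      (show 1 < (G.neighborSet x ∩ S).ncard by omega) s
    exact hindep s ⟨hxs, hsS⟩ y hy (hnbr y hy.2 hys x hxF hx hy.1.symm)
  obtain ⟨p, hpF, hps, hxp⟩ := hF x hxF s hsF hxs
  have hpS := hFS p hpF hps
  let F' : Set ↥Sᶜ := {w | (w : V) ∈ F}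
  have hF' : ∀ c ∉ F', c ≠ ⟨x, hx⟩ → ∀ h ∈ F', (G.induce Sᶜ).Adj c h →
      ∃ h' ∈ F', h' ≠ h ∧ (G.induce Sᶜ).Adj c h' := by
    rintro ⟨c, hc⟩ hcF hcx ⟨h, hh⟩ hhF hadj
    obtain ⟨w, hw, hne, hcw⟩ := hF c hcF h hhF hadj
    have hws : w ≠ s := by
      rintro rfl
      exact hcx (Subtype.ext (huniq w hsS c hc x hx hcw.symm hxs.symm))
    exact ⟨⟨w, hFS w hw hws⟩, hw, fun h => hne (congrArg Subtype.val h), hcw⟩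
  have hmax : ∀ r : ↥Sᶜ, ∃ g ∈ F', ∀ f ∈ F',
      (G.induce Sᶜ).dist r f ≤ (G.induce Sᶜ).dist r g := fun r =>
    Set.exists_max_image F' _ F'.toFinite ⟨⟨p, hpS⟩, hpF⟩
  have hedge : ∀ g ∈ F', ∀ v ∈ S, G.Adj g v → v ∈ G.neighborSet s ∩ S := by
    intro g hg v hv hgv
    refine ⟨hnbr v hv ?_ g hg g.2 hgv.symm, hv⟩
    rintro rfl
    exact hxF (huniq v hsS g g.2 x hx hgv.symm hxs.symm ▸ hg)
  obtain ⟨f, hf, hfmax⟩ := hmax ⟨x, hx⟩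
  have hfle : ∀ a, (G.induce Sᶜ).Adj f a →
      (G.induce Sᶜ).dist ⟨x, hx⟩ a ≤ (G.induce Sᶜ).dist ⟨x, hx⟩ f := by
    intro a ha
    by_contra! hlt
    have := htree.eq_of_adj_of_dist_lt_of_forall_dist_le hf hfmax hF' ha hlt
    rw [this, dist_self] at hlt
    omega
  have hfleaf : {w : V | w ∈ Sᶜ ∧ G.Adj f w}.ncard ≤ 1 := by
    refine (Set.ncard_le_one_iff (Set.toFinite _)).2 fun {a b} ha hb => ?_
    exact congrArg Subtype.val (htree.eq_of_adj_of_dist_le ⟨x, hx⟩ (v := f) (a := ⟨a, ha.1⟩)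
      (b := ⟨b, hb.1⟩) ha.2 hb.2 (hfle _ ha.2) (hfle _ hb.2))
  have hsf : G.neighborSet f ∩ S = G.neighborSet s ∩ S := by
    refine Set.eq_of_subset_of_ncard_le (fun v hv => hedge f hf v hv.2 hv.1) ?_
    have h1 := hreg.ncard_inter_add_ncard S f
    have h2 := hreg.ncard_inter_add_ncard S s
    have h3 := hone s hsS
    omega
  have hsingle : ∀ g ∈ F', g = f := by
    obtain ⟨g, hg, hgmax⟩ := hmax f
    have hgf : g = f := by
      by_contra hgf
      have hempty : (G.neighborSet g ∩ S) = ∅ := by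
        refine Set.eq_empty_of_forall_notMem fun v hv => hgf (Subtype.ext ?_)
        have hvf : v ∈ G.neighborSet f ∩ S := hsf ▸ hedge g hg v hv.2 hv.1
        exact huniq v hv.2 g g.2 f f.2 hv.1.symm hvf.1.symm
      have hcard := hreg.ncard_inter_add_ncard S g
      rw [hempty, Set.ncard_empty] at hcard
      have hle : ({w : V | w ∈ Sᶜ ∧ G.Adj g w} \ {x}).ncard ≤ 1 := by
        have hdist : ∀ a : ↥Sᶜ, (G.induce Sᶜ).Adj g a → (a : V) ≠ x →
            (G.induce Sᶜ).dist f a ≤ (G.induce Sᶜ).dist f g := by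
          intro a ha hax
          by_contra! hlt
          exact hax (congrArg Subtype.val
            (htree.eq_of_adj_of_dist_lt_of_forall_dist_le hg hgmax hF' ha hlt))
        refine (Set.ncard_le_one_iff (Set.toFinite _)).2 fun {a b} ha hb => ?_
        exact congrArg Subtype.val (htree.eq_of_adj_of_dist_le f (v := g) (a := ⟨a, ha.1.1⟩)
          (b := ⟨b, hb.1.1⟩) ha.1.2 hb.1.2 (hdist _ ha.1.2 ha.2) (hdist _ hb.1.2 hb.2))
      have := Set.pred_ncard_le_ncard_sdiff_singleton {w : V | w ∈ Sᶜ ∧ G.Adj g w} x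
      omega
    intro h hh
    have hle := hgmax h hh
    rw [hgf, dist_self] at hle
    exact ((htree.connected.dist_eq_zero_iff).1 (Nat.le_zero.1 hle)).symm
  have hpf := hsingle ⟨p, hpS⟩ hpF
  subst hpf
  exact ⟨p, hpS, hxp, fun w hw hpw => (Set.ncard_le_one_iff (Set.toFinite _)).1 hfleaf ⟨hw, hpw⟩ ⟨hx, hxp.symm⟩,
    hsf.symm⟩

end SimpleGraph

/-- In the setting of Statement 10, if `X = N(x) ∩ S` is an independent
set of `G`, then `N(xᵢ) ∩ S = N(xⱼ) ∩ S` for all `xᵢ, xⱼ ∈ X`, this common set is an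
independent set of cardinality `Δ − 1`; moreover if some `yᵢ` in it has its unique
neighbor `zᵢ ∈ S̄` a leaf of the tree `G[S̄]`, then `N(N(xᵢ) ∩ S) ∩ S̄ = {zᵢ}`. -/
theorem stmt12 {V : Type*} [Fintype V] (G : SimpleGraph V) [DecidableRel G.Adj]
    (n Δ : ℕ) (hn : Fintype.card V = n) (hΔ3 : 3 ≤ Δ)
    (hreg : G.IsRegularOfDegree Δ) (hconn : G.Connected)
    (hZ : (Δ - 1) * G.zeroForcingNumber = (Δ - 2) * n + 2)
    (S : Set V) (hzf : G.IsZeroForcingSet S)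
    (hSc : (G.induce Sᶜ).Connected)
    (hmin : ∀ T : Set V, G.IsZeroForcingSet T → (G.induce Tᶜ).Connected →
      S.ncard ≤ T.ncard)
    (htree : (G.induce Sᶜ).IsTree)
    (hone : ∀ v ∈ S, {w : V | w ∈ Sᶜ ∧ G.Adj v w}.ncard = 1)
    (hcard2 : 2 ≤ (Sᶜ : Set V).ncard)
    (x : V) (hx : x ∈ Sᶜ) (hleaf : {w : V | w ∈ Sᶜ ∧ G.Adj x w}.ncard = 1)
    (hindep : ∀ a ∈ G.neighborSet x ∩ S, ∀ b ∈ G.neighborSet x ∩ S, ¬ G.Adj a b) :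
    (∀ xi ∈ G.neighborSet x ∩ S, ∀ xj ∈ G.neighborSet x ∩ S,
        G.neighborSet xi ∩ S = G.neighborSet xj ∩ S) ∧
      (∀ xi ∈ G.neighborSet x ∩ S,
        (G.neighborSet xi ∩ S).ncard = Δ - 1 ∧
        (∀ a ∈ G.neighborSet xi ∩ S, ∀ b ∈ G.neighborSet xi ∩ S, ¬ G.Adj a b)) ∧
      (∀ xi ∈ G.neighborSet x ∩ S, ∀ yi ∈ G.neighborSet xi ∩ S, ∀ zi ∈ Sᶜ,
        G.Adj yi zi → {w : V | w ∈ Sᶜ ∧ G.Adj zi w}.ncard = 1 →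
        (⋃ y ∈ G.neighborSet xi ∩ S, G.neighborSet y) ∩ Sᶜ = {zi}) := by
  have hncard := hreg.ncard_eq_zeroForcingNumber (by omega) (hn.symm ▸ hZ) htree hone
  have hnot : ∀ s ∈ S, ¬ G.IsZeroForcingSet (S \ {s}) := by
    intro s hs h
    have h1 : G.zeroForcingNumber ≤ (S \ {s}).ncard := Nat.sInf_le ⟨_, h, rfl⟩
    have h2 := Set.ncard_sdiff_singleton_lt_of_mem hs
    omega
  obtain ⟨p, hp⟩ := Set.ncard_eq_one.1 hleaf
  have hxp : p ∈ {w : V | w ∈ Sᶜ ∧ G.Adj x w} := hp ▸ rfl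
  have key : ∀ s ∈ G.neighborSet x ∩ S, (∀ w ∈ Sᶜ, G.Adj p w → w = x) ∧
      G.neighborSet s ∩ S = G.neighborSet p ∩ S := by
    intro s hs
    obtain ⟨q, hq, hxq, h⟩ := hreg.exists_neighborSet_inter_eq hΔ3 hzf htree hone hx hleaf hindep
      hs (hnot s hs.2)
    have hqp : q ∈ {w : V | w ∈ Sᶜ ∧ G.Adj x w} := ⟨hq, hxq⟩
    rw [hp, Set.mem_singleton_iff] at hqp
    exact hqp ▸ h
  have hcard : ∀ v, {w : V | w ∈ Sᶜ ∧ G.Adj v w}.ncard = 1 →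
      (G.neighborSet v ∩ S).ncard = Δ - 1 := fun v hv => by
    have := hreg.ncard_inter_add_ncard S v
    omega
  refine ⟨fun a ha b hb => (key a ha).2.trans (key b hb).2.symm, fun s hs => ⟨hcard s (hone s hs.2),
    fun a ha b hb hab => ?_⟩, fun s hs y hy z hz hyz _ => ?_⟩
  · have hsub : G.neighborSet x ∩ S ⊆ G.neighborSet a ∩ S := by
      intro t ht
      have hat : a ∈ G.neighborSet t ∩ S := by rwa [(key t ht).2, ← (key s hs).2]
      exact ⟨hat.1.symm, ht.2⟩
    have heq := Set.eq_of_subset_of_ncard_le hsub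
      ((hcard a (hone a ha.2)).trans (hcard x hleaf).symm).le
    have hbx : b ∈ G.neighborSet x ∩ S := heq ▸ ⟨hab, hb.2⟩
    exact hindep s hs b hbx hb.1
  · have huniq : ∀ v ∈ G.neighborSet s ∩ S, ∀ w ∈ Sᶜ, G.Adj v w → w = p := by
      intro v hv w hw hvw
      have hvp : v ∈ G.neighborSet p ∩ S := (key s hs).2 ▸ hv
      exact (Set.ncard_le_one_iff (Set.toFinite _)).1 (hone v hv.2).le ⟨hw, hvw⟩ ⟨hxp.1, hvp.1.symm⟩
    obtain rfl := huniq y hy z hz hyz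
    ext w
    simp only [Set.mem_inter_iff, Set.mem_iUnion, Set.mem_singleton_iff, exists_prop]
    constructor
    · rintro ⟨⟨v, hv, hvw⟩, hw⟩
      exact huniq v hv w hw hvw
    · rintro rfl
      exact ⟨⟨y, hy, hyz⟩, hz⟩
end

section
/- Let G be a connected Δ-regular finite simple graph of order n with Δ ≥ 3 satisfying (Δ−1)·Z(G) = (Δ−2)·n + 2. Let S be a zero forcing set of G of minimum cardinality among all zero forcing sets whose complement induces a connected subgraph, and let S̄ = V(G)∖S. If |S̄| = 2, then G is isomorphic to the complete bipartite graph K_{Δ,Δ}. -/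
namespace SimpleGraph

variable {V : Type*} {G : SimpleGraph V}

theorem ZeroForces.trans {S T : Set V} (h : ∀ v ∈ T, G.ZeroForces S v) {v : V}
    (hv : G.ZeroForces T v) : G.ZeroForces S v := by
  induction hv with
  | init hv => exact h _ hv
  | force _ hadj _ ihu ih => exact .force ihu hadj ih

/-- A vertex outside `U` with a unique neighbor `w` in `U` reduces forcing `U` to forcing
`U \ {w}`. -/
theorem IsZeroForcingSet.of_diff_singleton {U : Set V} {u w : V} (hu : u ∉ U) (huw : G.Adj u w)
    (huniq : ∀ v ∈ U, G.Adj u v → v = w) (h : G.IsZeroForcingSet (U \ {w})ᶜ) :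
    G.IsZeroForcingSet Uᶜ := by
  refine fun v ↦ ZeroForces.trans (fun x hx ↦ ?_) (h v)
  by_cases hxU : x ∈ U
  · obtain rfl : x = w := by
      by_contra hne
      exact hx ⟨hxU, hne⟩
    exact .force (.init hu) huw fun v huv hne ↦ .init fun hvU ↦ hne (huniq v hvU huv)
  · exact .init hxU

theorem isZeroForcingSet_compl_empty : G.IsZeroForcingSet (∅ : Set V)ᶜ :=
  fun _ ↦ .init (by simp)

theorem isZeroForcingSet_compl_pair_s14 {a b u : V} (hub : u ≠ b) (hua : G.Adj u a)
    (hnb : ¬ G.Adj u b) (hab : G.Adj a b) : G.IsZeroForcingSet ({a, b} : Set V)ᶜ := by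
  refine .of_diff_singleton (u := u) (w := a) (by simp [hua.ne, hub]) hua ?_ ?_
  · rintro v (rfl | rfl) huv
    · rfl
    · exact absurd huv hnb
  · refine .of_diff_singleton (u := a) (w := b) (by simp) hab ?_ ?_
    · rintro v ⟨rfl | rfl, hv⟩ -
      · exact absurd rfl hv
      · rfl
    · convert isZeroForcingSet_compl_empty using 2
      ext v
      simp only [Set.mem_sdiff, Set.mem_insert_iff, Set.mem_singleton_iff, Set.mem_empty_iff_false]
      tauto

theorem isZeroForcingSet_compl_triple {a b u x d : V} (hub : u ≠ b) (hua : G.Adj u a)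
    (hnb : ¬ G.Adj u b) (hab : G.Adj a b) (hda : d ≠ a) (hdb : d ≠ b) (hxa : x ≠ a) (hxb : x ≠ b)
    (hdx : G.Adj d x) (hnda : ¬ G.Adj d a) (hndb : ¬ G.Adj d b) :
    G.IsZeroForcingSet ({x, a, b} : Set V)ᶜ := by
  refine .of_diff_singleton (u := d) (w := x) (by simp [hda, hdb, hdx.ne]) hdx ?_ ?_
  · rintro v (rfl | rfl | rfl) hdv
    · rfl
    · exact absurd hdv hnda
    · exact absurd hdv hndb
  · have : ({x, a, b} : Set V) \ {x} = {a, b} :=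
      Set.insert_sdiff_self_of_notMem (by simp [hxa, hxb])
    rw [this]
    exact isZeroForcingSet_compl_pair_s14 hub hua hnb hab

theorem IsZeroForcingSet.exists_separating {S : Set V} (h : G.IsZeroForcingSet S) {a b : V}
    (hne : a ≠ b) (hS : Sᶜ = {a, b}) : ∃ u ∈ S, ¬ (G.Adj u a ↔ G.Adj u b) := by
  by_contra! hall
  have key : ∀ v, G.ZeroForces S v → v ∈ S := by
    intro v hv
    induction hv with
    | init hv => exact hv
    | @force u w _ hadj _ ihu ih =>
      by_contra hw
      have hmem (y : V) : y ∉ S ↔ y = a ∨ y = b := by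
        rw [← Set.mem_compl_iff, hS]; simp
      rcases (hmem w).1 hw with rfl | rfl
      · exact (hmem b).2 (.inr rfl) (ih b ((hall u ihu).1 hadj) hne.symm)
      · exact (hmem a).2 (.inl rfl) (ih a ((hall u ihu).2 hadj) hne)
  have : a ∈ Sᶜ := by simp [hS]
  exact this (key a (h a))

theorem Connected.forall_of_adj (hconn : G.Connected) {P : V → Prop} {a : V} (ha : P a)
    (h : ∀ x y, G.Adj x y → P x → P y) (v : V) : P v := by
  obtain ⟨p⟩ := hconn.preconnected a v
  induction p with
  | nil => exact ha
  | cons hadj _ ih => exact ih (h _ _ hadj ha)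

theorem connected_induce_triple {a b x : V} (hab : G.Adj a b) (hx : G.Adj a x ∨ G.Adj b x) :
    (G.induce ({x, a, b} : Set V)).Connected := by
  rcases hx with hx | hx
  · have := induce_union_connected (induce_pair_connected_of_adj hx.symm).preconnected
      (induce_pair_connected_of_adj hab).preconnected ⟨a, by simp, by simp⟩
    rwa [show ({x, a} ∪ {a, b} : Set V) = {x, a, b} by grind] at this
  · have := induce_union_connected (induce_pair_connected_of_adj hx.symm).preconnected
      (induce_pair_connected_of_adj hab).preconnected ⟨b, by simp, by simp⟩
    rwa [show ({x, b} ∪ {a, b} : Set V) = {x, a, b} by grind] at this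

/-- If no connected triple is the complement of a zero forcing set, then the neighborhoods of
the ends of an edge which are not twins partition the vertex set. -/
theorem adj_iff_not_adj_of_no_triple [Fintype V] [DecidableRel G.Adj] {Δ : ℕ}
    (hreg : G.IsRegularOfDegree Δ) (hconn : G.Connected) (hn : 2 * Δ ≤ Fintype.card V)
    (H : ∀ U : Set V, U.ncard = 3 → G.IsZeroForcingSet Uᶜ → ¬ (G.induce U).Connected)
    {a b u : V} (hub : u ≠ b) (hua : G.Adj u a) (hnb : ¬ G.Adj u b) (hab : G.Adj a b) (v : V) :
    G.Adj b v ↔ ¬ G.Adj a v := by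
  classical
  have hdom : ∀ v, G.Adj a v ∨ G.Adj b v := by
    refine hconn.forall_of_adj (a := a) (.inr hab.symm) fun x y hxy hx ↦ ?_
    by_contra! hy
    have hya : y ≠ a := by rintro rfl; exact hy.2 hab.symm
    have hyb : y ≠ b := by rintro rfl; exact hy.1 hab
    have hxa : x ≠ a := by rintro rfl; exact hy.1 hxy
    have hxb : x ≠ b := by rintro rfl; exact hy.2 hxy
    exact H {x, a, b} (Set.ncard_eq_three.2 ⟨x, a, b, hxa, hxb, hab.ne, rfl⟩)
      (isZeroForcingSet_compl_triple hub hua hnb hab hya hyb hxa hxb hxy.symm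
        (fun h ↦ hy.1 h.symm) fun h ↦ hy.2 h.symm) (connected_induce_triple hab hx)
  have hunion : G.neighborFinset a ∪ G.neighborFinset b = Finset.univ := by
    ext v; simpa using hdom v
  have hinter : G.neighborFinset a ∩ G.neighborFinset b = ∅ := by
    have := Finset.card_union_add_card_inter (G.neighborFinset a) (G.neighborFinset b)
    rw [hunion, Finset.card_univ, card_neighborFinset_eq_degree, card_neighborFinset_eq_degree,
      hreg a, hreg b] at this
    exact Finset.card_eq_zero.1 (by omega)
  have hv : v ∉ G.neighborFinset a ∩ G.neighborFinset b := by simp [hinter]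
  have := hdom v
  simp only [Finset.mem_inter, mem_neighborFinset] at hv
  tauto

theorem nonempty_iso_completeBipartiteGraph_s14 [Fintype V] {Δ : ℕ} (p : V → Prop)
    (hp : Nat.card {v // p v} = Δ) (hnp : Nat.card {v // ¬ p v} = Δ)
    (h : ∀ x y, G.Adj x y ↔ (p y ↔ ¬ p x)) :
    Nonempty (G ≃g completeBipartiteGraph (Fin Δ) (Fin Δ)) := by
  classical
  let e : V ≃ Fin Δ ⊕ Fin Δ := (Equiv.sumCompl p).symm.trans
    (Equiv.sumCongr (Finite.equivFinOfCardEq hp) (Finite.equivFinOfCardEq hnp))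
  refine ⟨⟨e, fun {x y} ↦ ?_⟩⟩
  rw [h]
  by_cases hx : p x <;> by_cases hy : p y <;> simp [e, hx, hy]

end SimpleGraph

open SimpleGraph

/-- Under the equality hypothesis, if `|S̄| = 2` then `G` is isomorphic
to the complete bipartite graph `K_{Δ,Δ}`. -/
theorem stmt14 {V : Type*} [Fintype V] (G : SimpleGraph V) [DecidableRel G.Adj]
    (n Δ : ℕ) (hn : Fintype.card V = n) (hΔ3 : 3 ≤ Δ)
    (hreg : G.IsRegularOfDegree Δ) (hconn : G.Connected)
    (hZ : (Δ - 1) * G.zeroForcingNumber = (Δ - 2) * n + 2)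
    (S : Set V) (hzf : G.IsZeroForcingSet S)
    (hSc : (G.induce Sᶜ).Connected)
    (hmin : ∀ T : Set V, G.IsZeroForcingSet T → (G.induce Tᶜ).Connected →
      S.ncard ≤ T.ncard)
    (hcard : (Sᶜ : Set V).ncard = 2) :
    Nonempty (G ≃g completeBipartiteGraph (Fin Δ) (Fin Δ)) := by
  have hSn : S.ncard + 2 = n := by
    rw [← hcard, ← hn, ← Nat.card_eq_fintype_card]
    exact Set.ncard_add_ncard_compl S
  have hlarge : 2 * Δ ≤ Fintype.card V := by
    have hle : G.zeroForcingNumber ≤ S.ncard := Nat.sInf_le ⟨S, hzf, rfl⟩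
    obtain ⟨k, rfl⟩ := Nat.exists_eq_add_of_le' (show 2 ≤ Δ by omega)
    rw [show k + 2 - 1 = k + 1 by omega, Nat.add_sub_cancel, ← hSn] at hZ
    have := Nat.mul_le_mul_left (k + 1) hle
    rw [hn, ← hSn]
    nlinarith
  have H : ∀ U : Set V, U.ncard = 3 → G.IsZeroForcingSet Uᶜ → ¬ (G.induce U).Connected := by
    intro U hU hUzf hUc
    have := hmin Uᶜ hUzf (by rwa [compl_compl])
    have hU' := Set.ncard_add_ncard_compl U
    rw [Nat.card_eq_fintype_card] at hU'
    omega
  have main : ∃ a b u, u ≠ b ∧ G.Adj u a ∧ ¬ G.Adj u b ∧ G.Adj a b := by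
    obtain ⟨a, b, hne, hS⟩ := Set.ncard_eq_two.1 hcard
    have hab : G.Adj a b := by
      rw [hS] at hSc
      have : Nontrivial ({a, b} : Set V) :=
        ⟨⟨a, by simp⟩, ⟨b, by simp⟩, by simpa using hne⟩
      obtain ⟨⟨y, hy⟩, hay⟩ := hSc.preconnected.exists_adj_of_nontrivial ⟨a, by simp⟩
      rcases hy with rfl | rfl
      · exact absurd hay (by simp)
      · simpa using hay
    obtain ⟨u, hu, hsep⟩ := hzf.exists_separating hne hS
    have hmem (y : V) (h : y = a ∨ y = b) : y ∉ S := by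
      rw [← Set.mem_compl_iff, hS]; simpa using h
    by_cases hua : G.Adj u a
    · exact ⟨a, b, u, fun h ↦ hmem u (.inr h) hu, hua, by tauto, hab⟩
    · exact ⟨b, a, u, fun h ↦ hmem u (.inl h) hu, by tauto, hua, hab.symm⟩
  obtain ⟨a, b, u, hub, hua, hnb, hab⟩ := main
  have key {a b u : V} (hub : u ≠ b) (hua : G.Adj u a) (hnb : ¬ G.Adj u b) (hab : G.Adj a b)
      (v : V) : G.Adj b v ↔ ¬ G.Adj a v :=
    adj_iff_not_adj_of_no_triple hreg hconn hlarge H hub hua hnb hab v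
  have hb : ∀ v, G.Adj b v ↔ ¬ G.Adj a v := key hub hua hnb hab
  have hfst : ∀ x, G.Adj a x → ∀ v, G.Adj x v ↔ ¬ G.Adj a v := by
    intro x hx
    rcases eq_or_ne b x with rfl | hbx
    · exact hb
    · exact key hbx hab.symm (fun h ↦ (hb x).1 h hx) hx
  have hsnd : ∀ x, ¬ G.Adj a x → ∀ v, G.Adj x v ↔ G.Adj a v := by
    intro x hx v
    rcases eq_or_ne a x with rfl | hax
    · rfl
    · rw [key hax hab hx ((hb x).2 hx) v, hb v, not_not]
  have hcardN (x : V) : Nat.card {v // G.Adj x v} = Δ := by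
    rw [← hreg x, ← card_neighborSet_eq_degree, ← Nat.card_eq_fintype_card]
    rfl
  refine nonempty_iso_completeBipartiteGraph_s14 (G.Adj a) (hcardN a) ?_ fun x y ↦ ?_
  · simp_rw [← hb]
    exact hcardN b
  · by_cases hx : G.Adj a x
    · simp [hfst x hx y, hx]
    · simp [hsnd x hx y, hx]
end
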